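/- arXiv:2108.03029 — 9 statements merged into one kernel-verified Lean document; each statement's English description precedes it below -/
import Mathlib

section
/- Let l01, l02, l11, l21 and α01, α02, β1 be positive integers, and let G be the associated 5×5 matrix over ℚ. Then G has rank at least 4; in fact the 4×4 minor obtained by deleting the third row and the first column equals α02·l11·l21, which is nonzero. -/
theorem Matrix.card_le_rank_of_det_submatrix_ne_zero {m n k K : Type*} [Fintype n] [Fintype k]
    [DecidableEq k] [Field K] (A : Matrix m n K) (r : k → m) (c : k → n)
    (h : (A.submatrix r c).det ≠ 0) : Fintype.card k ≤ A.rank := by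
  rw [← Matrix.rank_of_isUnit _ ((Matrix.isUnit_iff_isUnit_det _).2 h.isUnit)]
  exact Matrix.rank_submatrix_le A r c

/-- Given positive integers `l01, l02, l11, l21` and `α01, α02, β1`, the associated
5×5 matrix `G` over ℚ has rank at least 4; in fact the 4×4 minor obtained by deleting
the third row and the first column equals `α02 · l11 · l21`, which is nonzero. -/
theorem statement_0 (l01 l02 l11 l21 a01 a02 b1 : ℕ)
    (hl01 : 0 < l01) (hl02 : 0 < l02) (hl11 : 0 < l11) (hl21 : 0 < l21)
    (ha01 : 0 < a01) (ha02 : 0 < a02) (hb1 : 0 < b1) :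
    let G : Matrix (Fin 5) (Fin 5) ℚ :=
      !![1 - (l01 : ℚ) - (a01 : ℚ), 1 - (l02 : ℚ), 1, 1, 1;
         1 - (l01 : ℚ), 1 - (l02 : ℚ) - (a02 : ℚ), 1, 1, 1;
         1 - (l01 : ℚ), 1 - (l02 : ℚ), 1, 1, 1 - (b1 : ℚ);
         -(l01 : ℚ), -(l02 : ℚ), (l11 : ℚ), 0, 0;
         -(l01 : ℚ), -(l02 : ℚ), 0, (l21 : ℚ), 0]
    (G.submatrix ![0, 1, 3, 4] ![1, 2, 3, 4]).det = (a02 : ℚ) * l11 * l21 ∧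
      (a02 : ℚ) * l11 * l21 ≠ 0 ∧
      4 ≤ G.rank := by
  intro G
  have hdet : (G.submatrix ![0, 1, 3, 4] ![1, 2, 3, 4]).det = (a02 : ℚ) * l11 * l21 := by
    have hsub : G.submatrix ![0, 1, 3, 4] ![1, 2, 3, 4] =
        !![1 - (l02 : ℚ), 1, 1, 1;
           1 - (l02 : ℚ) - (a02 : ℚ), 1, 1, 1;
           -(l02 : ℚ), (l11 : ℚ), 0, 0;
           -(l02 : ℚ), 0, (l21 : ℚ), 0] := by
      ext i j
      fin_cases i <;> fin_cases j <;> rfl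
    rw [hsub]
    simp [Matrix.det_succ_row_zero, Fin.sum_univ_succ, Fin.succAbove]
    ring
  have hne : (a02 : ℚ) * l11 * l21 ≠ 0 := by positivity
  refine ⟨hdet, hne, ?_⟩
  exact G.card_le_rank_of_det_submatrix_ne_zero _ _ (hdet ▸ hne)
end

section
/- Let l01, l02, l11, l21 and α01, α02, β1 be positive integers, and let G be the associated 5×5 matrix over ℚ. Then det(G) = 0 holds if and only if the rational identity 1/β1 + 1/α01 + 1/α02 + (l01/α01 + l02/α02)·(1/l11 + 1/l21 − 1) = 1 is satisfied. -/
/-- The determinant of `G` is the product of the clearing denominators with the defect of the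
rational identity. -/
lemma det_eq_mul_defect {K : Type*} [Field K] (l1 l2 m n a c b : K)
    (ha : a ≠ 0) (hc : c ≠ 0) (hm : m ≠ 0) (hn : n ≠ 0) (hb : b ≠ 0) :
    Matrix.det !![1 - l1 - a, 1 - l2, 1, 1, 1;
                  1 - l1, 1 - l2 - c, 1, 1, 1;
                  1 - l1, 1 - l2, 1, 1, 1 - b;
                  -l1, -l2, m, 0, 0;
                  -l1, -l2, 0, n, 0] =
      a * c * m * n * b *
        (1 / b + 1 / a + 1 / c + (l1 / a + l2 / c) * (1 / m + 1 / n - 1) - 1) := by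
  simp [Matrix.det_succ_row_zero, Fin.sum_univ_succ, Fin.succAbove]
  field_simp
  ring

/-- Given positive integers `l01, l02, l11, l21` and `α01, α02, β1`, the associated
5×5 matrix `G` over ℚ satisfies `det G = 0` if and only if
`1/β1 + 1/α01 + 1/α02 + (l01/α01 + l02/α02)·(1/l11 + 1/l21 − 1) = 1`. -/
theorem statement_1 (l01 l02 l11 l21 a01 a02 b1 : ℕ)
    (hl01 : 0 < l01) (hl02 : 0 < l02) (hl11 : 0 < l11) (hl21 : 0 < l21)
    (ha01 : 0 < a01) (ha02 : 0 < a02) (hb1 : 0 < b1) :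
    let G : Matrix (Fin 5) (Fin 5) ℚ :=
      !![1 - (l01 : ℚ) - (a01 : ℚ), 1 - (l02 : ℚ), 1, 1, 1;
         1 - (l01 : ℚ), 1 - (l02 : ℚ) - (a02 : ℚ), 1, 1, 1;
         1 - (l01 : ℚ), 1 - (l02 : ℚ), 1, 1, 1 - (b1 : ℚ);
         -(l01 : ℚ), -(l02 : ℚ), (l11 : ℚ), 0, 0;
         -(l01 : ℚ), -(l02 : ℚ), 0, (l21 : ℚ), 0]
    G.det = 0 ↔
      1 / (b1 : ℚ) + 1 / (a01 : ℚ) + 1 / (a02 : ℚ) +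
          ((l01 : ℚ) / (a01 : ℚ) + (l02 : ℚ) / (a02 : ℚ)) *
            (1 / (l11 : ℚ) + 1 / (l21 : ℚ) - 1) = 1 := by
  have pos {x : ℕ} (h : 0 < x) : (x : ℚ) ≠ 0 := Nat.cast_ne_zero.2 h.ne'
  intro G
  rw [show G.det = _ from det_eq_mul_defect _ _ _ _ _ _ _ (pos ha01) (pos ha02) (pos hl11)
    (pos hl21) (pos hb1)]
  simp only [mul_eq_zero, pos ha01, pos ha02, pos hl11, pos hl21, pos hb1, false_or, sub_eq_zero]
end

section
/- In the polynomial ring K[T_{ij}] the ideal generated by all trinomials g_I, where I runs over all triples (i1,i2,i3) with 0 ≤ i1 < i2 < i3 ≤ r, equals the ideal generated by the r−1 consecutive trinomials g_i := g_{i,i+1,i+2} for i = 0, …, r−2. -/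
open MvPolynomial

/-- The trinomial `g_{i1,i2,i3}` attached to a triple of indices: the determinant of
the 3×3 matrix whose first row consists of the monomials `T_{i}^{l_i}` for `i = i1, i2, i3`
and whose second and third rows consist of the entries of the columns `a_{i1}, a_{i2}, a_{i3}`
of the 2×(r+1) matrix `A`. -/
noncomputable def trinomialG {r : ℕ} {K : Type*} [Field K] {n : Fin (r + 1) → ℕ}
    (l : (i : Fin (r + 1)) → Fin (n i) → ℕ) (A : Matrix (Fin 2) (Fin (r + 1)) K)
    (i1 i2 i3 : Fin (r + 1)) :
    MvPolynomial ((i : Fin (r + 1)) × Fin (n i)) K :=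
  Matrix.det
    !![∏ j : Fin (n i1), (MvPolynomial.X ⟨i1, j⟩ : MvPolynomial ((i : Fin (r + 1)) × Fin (n i)) K) ^ l i1 j,
        ∏ j : Fin (n i2), (MvPolynomial.X ⟨i2, j⟩ : MvPolynomial ((i : Fin (r + 1)) × Fin (n i)) K) ^ l i2 j,
        ∏ j : Fin (n i3), (MvPolynomial.X ⟨i3, j⟩ : MvPolynomial ((i : Fin (r + 1)) × Fin (n i)) K) ^ l i3 j;
      MvPolynomial.C (A 0 i1), MvPolynomial.C (A 0 i2), MvPolynomial.C (A 0 i3);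
      MvPolynomial.C (A 1 i1), MvPolynomial.C (A 1 i2), MvPolynomial.C (A 1 i3)]

section Exchange

variable {r : ℕ} {K : Type*} [Field K] {n : Fin (r + 1) → ℕ}
  (l : (i : Fin (r + 1)) → Fin (n i) → ℕ) (A : Matrix (Fin 2) (Fin (r + 1)) K)

/-- A three-term Plücker relation between trinomials sharing the index `j`. -/
theorem trinomialG_plucker (i j k m : Fin (r + 1)) :
    C (A 0 j * A 1 k - A 0 k * A 1 j) * trinomialG l A i j m =
      C (A 0 j * A 1 m - A 0 m * A 1 j) * trinomialG l A i j k +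
        C (A 0 i * A 1 j - A 0 j * A 1 i) * trinomialG l A j k m := by
  simp only [trinomialG, Matrix.det_fin_three, Matrix.of_apply, Matrix.cons_val, C_sub, C_mul]
  ring

theorem trinomialG_swap_left (i j k : Fin (r + 1)) :
    trinomialG l A j i k = -trinomialG l A i j k := by
  simp only [trinomialG, Matrix.det_fin_three, Matrix.of_apply, Matrix.cons_val]
  ring

theorem trinomialG_swap_right (i j k : Fin (r + 1)) :
    trinomialG l A i k j = -trinomialG l A i j k := by
  simp only [trinomialG, Matrix.det_fin_three, Matrix.of_apply, Matrix.cons_val]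
  ring

variable {l A} {J : Ideal (MvPolynomial ((i : Fin (r + 1)) × Fin (n i)) K)}

/-- If the columns `j` and `k` are independent, an ideal containing `g_{i,j,k}` and `g_{j,k,m}`
contains `g_{i,j,m}`. -/
theorem trinomialG_mem_of_mem {i j k m : Fin (r + 1)}
    (hjk : LinearIndependent K ![(fun s => A s j), (fun s => A s k)])
    (h₁ : trinomialG l A i j k ∈ J) (h₂ : trinomialG l A j k m ∈ J) :
    trinomialG l A i j m ∈ J := by
  have hd : A 0 j * A 1 k - A 0 k * A 1 j ≠ 0 := by
    have hu := Matrix.linearIndependent_rows_iff_isUnit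
      (A := Matrix.of ![(fun s => A s j), (fun s => A s k)]) |>.mp hjk
    have hdet := ((Matrix.isUnit_iff_isUnit_det _).mp hu).ne_zero
    rw [Matrix.det_fin_two] at hdet
    simpa [mul_comm] using hdet
  have hu : IsUnit (C (σ := (i : Fin (r + 1)) × Fin (n i))
      (A 0 j * A 1 k - A 0 k * A 1 j)) := hd.isUnit.map C
  rw [← Ideal.unit_mul_mem_iff_mem J hu, trinomialG_plucker]
  exact J.add_mem (J.mul_mem_left _ h₁) (J.mul_mem_left _ h₂)

/-- An ideal containing the consecutive trinomials contains every `g_{i,m,m+1}` with `i < m`. -/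
theorem trinomialG_mem_of_succ
    (hA : ∀ i1 i2 : Fin (r + 1), i1 ≠ i2 →
      LinearIndependent K ![(fun k => A k i1), (fun k => A k i2)])
    (hJ : ∀ i (hi : i + 2 < r + 1),
      trinomialG l A ⟨i, by lia⟩ ⟨i + 1, by lia⟩ ⟨i + 2, hi⟩ ∈ J)
    (m : ℕ) (hm : m + 1 < r + 1) (i : ℕ) (hi : i < m) :
    trinomialG l A ⟨i, by lia⟩ ⟨m, by lia⟩ ⟨m + 1, hm⟩ ∈ J := by
  induction m with
  | zero => lia
  | succ m ih =>
    obtain rfl | him := (Nat.lt_succ_iff.mp hi).eq_or_lt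
    · exact hJ i hm
    · apply trinomialG_mem_of_mem (k := ⟨m, by lia⟩) (hA _ _ (by simp))
      · rw [trinomialG_swap_right]
        exact J.neg_mem (ih (by lia) him)
      · rw [trinomialG_swap_left]
        exact J.neg_mem (hJ m hm)

/-- An ideal containing the consecutive trinomials contains all trinomials. -/
theorem trinomialG_mem_of_lt
    (hA : ∀ i1 i2 : Fin (r + 1), i1 ≠ i2 →
      LinearIndependent K ![(fun k => A k i1), (fun k => A k i2)])
    (hJ : ∀ i (hi : i + 2 < r + 1),
      trinomialG l A ⟨i, by lia⟩ ⟨i + 1, by lia⟩ ⟨i + 2, hi⟩ ∈ J)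
    (i j k : ℕ) (hk : k < r + 1) (hij : i < j) (hjk : j < k) :
    trinomialG l A ⟨i, by lia⟩ ⟨j, by lia⟩ ⟨k, hk⟩ ∈ J := by
  induction k with
  | zero => lia
  | succ k ih =>
    obtain rfl | hjk' := (Nat.lt_succ_iff.mp hjk).eq_or_lt
    · exact trinomialG_mem_of_succ hA hJ j hk i hij
    · exact trinomialG_mem_of_mem (k := ⟨k, by lia⟩) (hA _ _ (by simp [Fin.ext_iff]; lia))
        (ih (by lia) hjk') (trinomialG_mem_of_succ hA hJ k hk j hjk')

end Exchange

/-- In the polynomial ring `K[T_{ij}]`, the ideal generated by all trinomials `g_I`,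
where `I` runs over all triples `(i1, i2, i3)` with `0 ≤ i1 < i2 < i3 ≤ r`, equals the
ideal generated by the `r − 1` consecutive trinomials `g_i := g_{i, i+1, i+2}` for
`i = 0, …, r − 2`. -/
theorem statement_2 (r : ℕ) (hr : 2 ≤ r) (K : Type*) [Field K]
    (n : Fin (r + 1) → ℕ) (hn : ∀ i, 1 ≤ n i)
    (l : (i : Fin (r + 1)) → Fin (n i) → ℕ) (hl : ∀ i j, 1 ≤ l i j)
    (A : Matrix (Fin 2) (Fin (r + 1)) K)
    (hA : ∀ i1 i2 : Fin (r + 1), i1 ≠ i2 →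
      LinearIndependent K ![(fun k => A k i1), (fun k => A k i2)]) :
    Ideal.span {p : MvPolynomial ((i : Fin (r + 1)) × Fin (n i)) K |
        ∃ i1 i2 i3 : Fin (r + 1), i1 < i2 ∧ i2 < i3 ∧ p = trinomialG l A i1 i2 i3} =
      Ideal.span {p : MvPolynomial ((i : Fin (r + 1)) × Fin (n i)) K |
        ∃ i1 i2 i3 : Fin (r + 1), (i2 : ℕ) = (i1 : ℕ) + 1 ∧ (i3 : ℕ) = (i1 : ℕ) + 2 ∧
          p = trinomialG l A i1 i2 i3} := by
  apply le_antisymm <;> rw [Ideal.span_le]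
  · rintro _ ⟨i1, i2, i3, h12, h23, rfl⟩
    exact trinomialG_mem_of_lt hA
      (fun _ _ => Ideal.subset_span (Exists.intro _ ⟨_, _, rfl, rfl, rfl⟩)) i1 i2 i3 i3.isLt h12 h23
  · rintro _ ⟨i1, i2, i3, h12, h13, rfl⟩
    exact Ideal.subset_span ⟨i1, i2, i3, by lia, by lia, rfl⟩
end

section
/- Let a, b, c, x, y be positive integers with a ≥ b and x ≥ y ≥ 2 satisfying the equation 1/c + (1/a + 1/b)·(1/x + 1/y) = 1 in ℚ. Then c ≥ 2, b ≤ 4, y ≤ 8, and moreover b ≤ 2 or y = 2. -/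
/-- Let `a, b, c, x, y` be positive integers with `a ≥ b` and `x ≥ y ≥ 2` satisfying
`1/c + (1/a + 1/b)·(1/x + 1/y) = 1` in ℚ. Then `c ≥ 2`, `b ≤ 4`, `y ≤ 8`, and moreover
`b ≤ 2` or `y = 2`. -/
theorem statement_4 (a b c x y : ℕ)
    (ha : 0 < a) (hb : 0 < b) (hc : 0 < c) (hx : 0 < x) (hy : 0 < y)
    (hab : b ≤ a) (hxy : y ≤ x) (hy2 : 2 ≤ y)
    (heq : 1 / (c : ℚ) + (1 / (a : ℚ) + 1 / (b : ℚ)) * (1 / (x : ℚ) + 1 / (y : ℚ)) = 1) :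
    2 ≤ c ∧ b ≤ 4 ∧ y ≤ 8 ∧ (b ≤ 2 ∨ y = 2) := by
  have ha' : (0 : ℚ) < a := by exact_mod_cast ha
  have hb' : (0 : ℚ) < b := by exact_mod_cast hb
  have hx' : (0 : ℚ) < x := by exact_mod_cast hx
  have hy' : (0 : ℚ) < y := by exact_mod_cast hy
  have hc2 : 2 ≤ c := by
    by_contra! hlt
    obtain rfl : c = 1 := by omega
    have hpos : (0 : ℚ) < (1 / (a : ℚ) + 1 / b) * (1 / (x : ℚ) + 1 / y) := by positivity
    norm_num at heq hpos
    rcases heq with h | h <;> simp [h] at hpos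
  have hc_inv : 1 / (c : ℚ) ≤ 1 / 2 :=
    one_div_le_one_div_of_le two_pos (by exact_mod_cast hc2)
  have hprod : (1 / (a : ℚ) + 1 / b) * (1 / (x : ℚ) + 1 / y) ≤
      (1 / (b : ℚ) + 1 / b) * (1 / (y : ℚ) + 1 / y) := by
    gcongr
  have hsimp : (1 / (b : ℚ) + 1 / b) * (1 / (y : ℚ) + 1 / y) = 4 / (b * y) := by
    field_simp
    norm_num
  have hbound : (1 : ℚ) / 2 ≤ 4 / (b * y) := by linarith
  have hby : b * y ≤ 8 := by
    rw [le_div_iff₀ (by positivity)] at hbound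
    have : (b : ℚ) * y ≤ 8 := by linarith
    exact_mod_cast this
  refine ⟨hc2, by nlinarith, by nlinarith, ?_⟩
  by_contra! h
  have hb3 : 3 ≤ b := h.1
  have hy3 : 3 ≤ y := by omega
  nlinarith
end

section
/- Let a, b, c, x, y be positive integers with a ≥ b and x ≥ y ≥ 2 satisfying the equation 1/c + (1/a + 1/b)·(1/x + 1/y) = 1 in ℚ. Then x ≤ 30, y ≤ 8, a ≤ 35, b ≤ 4 and c ≤ 36. -/
/-- The bounds claimed for a solution of `1/c + (1/a + 1/b)(1/x + 1/y) = 1`. -/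
def SolutionBounds (a b c x y : ℕ) : Prop :=
  x ≤ 30 ∧ y ≤ 8 ∧ a ≤ 35 ∧ b ≤ 4 ∧ c ≤ 36

instance (a b c x y : ℕ) : Decidable (SolutionBounds a b c x y) := by
  unfold SolutionBounds; infer_instance

/-- The bounds in a form invariant under exchanging `(a, b)` with `(x, y)`. -/
def SymmetricBounds (a b c x y : ℕ) : Prop :=
  (2 ≤ y → SolutionBounds a b c x y) ∧ (2 ≤ b → SolutionBounds x y c a b)

instance (a b c x y : ℕ) : Decidable (SymmetricBounds a b c x y) := by
  unfold SymmetricBounds; infer_instance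

/-- `R u v` holds for all solutions of `p / u + d / v = n` with `u ≤ 2 * p / n`. -/
def HoldsForSmall (n p d : ℕ) (R : ℕ → ℕ → Prop) : Prop :=
  ∀ u < 2 * p / n + 1, p < u * n → u * n - p ∣ d * u → R u (d * u / (u * n - p))

instance (n p d : ℕ) (R : ℕ → ℕ → Prop) [∀ u v, Decidable (R u v)] :
    Decidable (HoldsForSmall n p d R) := by
  unfold HoldsForSmall; infer_instance

lemma HoldsForSmall.apply {n p d u v : ℕ} {R : ℕ → ℕ → Prop} (H : HoldsForSmall n p d R)
    (hn : 0 < n) (hd : 0 < d) (hu : 0 < u) (h : n * v * u = p * v + d * u)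
    (hsmall : u * n ≤ 2 * p) : R u v := by
  have hpos : p < u * n := by
    have : v * p < v * (u * n) := by nlinarith [mul_pos hd hu]
    exact lt_of_mul_lt_mul_left this (Nat.zero_le _)
  have hprod : d * u = (u * n - p) * v := by
    rw [Nat.sub_mul]
    apply Nat.eq_sub_of_add_eq
    linarith
  have := H u (Nat.lt_succ_of_le ((Nat.le_div_iff_mul_le hn).2 hsmall)) hpos ⟨v, hprod⟩
  rwa [hprod, Nat.mul_div_cancel_left _ (by omega)] at this

/-- In `p / u + d / v = n`, one of the two summands is at least `n / 2`. -/
lemma le_two_mul_or_le_two_mul {n p d u v : ℕ} (hu : 0 < u) (hv : 0 < v)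
    (h : n * v * u = p * v + d * u) : u * n ≤ 2 * p ∨ v * n ≤ 2 * d := by
  by_contra! hlt
  nlinarith [mul_lt_mul_of_pos_left hlt.1 hv, mul_lt_mul_of_pos_left hlt.2 hu]

lemma symmetricBounds_of_small_left :
    ∀ b ∈ Finset.range 9, ∀ y ∈ Finset.range 9, b * y ∈ Finset.Icc 2 8 →
      ∀ a ∈ Finset.Ico b (7 * b), a + b < a * b * y →
      HoldsForSmall (a * b * y - (a + b)) (y * (a + b)) (a * b * y)
        (fun x c => y ≤ x → SymmetricBounds a b c x y) ∧
      HoldsForSmall (a * b * y - (a + b)) (a * b * y) (y * (a + b))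
        (fun c x => y ≤ x → SymmetricBounds a b c x y) := by
  decide +kernel

/-- A solution in which the ratio `a / b` is at most `x / y`. -/
lemma symmetricBounds_of_mul_le_mul {a b c x y : ℕ} (ha : 0 < a) (hb : 0 < b) (hc : 0 < c)
    (hx : 0 < x) (hy : 0 < y) (hab : b ≤ a) (hxy : y ≤ x) (hby : 2 ≤ b * y)
    (heq : a * b * x * y + c * ((a + b) * (x + y)) = c * (a * b * x * y))
    (hle : a * y ≤ b * x) : SymmetricBounds a b c x y := by
  have hax : 0 < a * x := by positivity
  have hK : a * x < (a + b) * (x + y) := by nlinarith [mul_pos hb hx]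
  have hc2 : 2 ≤ c := by
    by_contra! h
    obtain rfl : c = 1 := by omega
    omega
  have hM : a * b * x * y = a * x * (b * y) := by ring
  have hhalf : a * b * x * y ≤ 2 * ((a + b) * (x + y)) := by
    have : c * (a * b * x * y) ≤ c * (2 * ((a + b) * (x + y))) := by
      nlinarith [Nat.mul_le_mul_right (a * b * x * y) hc2]
    exact Nat.le_of_mul_le_mul_left this hc
  have hby8 : b * y ≤ 8 := by
    have h4 : (a + b) * (x + y) ≤ 4 * (a * x) := by
      have := Nat.mul_le_mul (show a + b ≤ 2 * a by omega) (show x + y ≤ 2 * x by omega)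
      linarith
    have : a * x * (b * y) ≤ a * x * 8 := by linarith
    exact Nat.le_of_mul_le_mul_left this hax
  have hratio : 4 * (a * x) ≤ 3 * ((a + b) * (x + y)) := by
    rcases hby.eq_or_lt with h2 | h3
    · rw [hM, ← h2] at heq
      have hc3 : 3 ≤ c := by
        by_contra! h
        obtain rfl : c = 2 := by omega
        omega
      have : c * (4 * (a * x)) ≤ c * (3 * ((a + b) * (x + y))) := by
        nlinarith [Nat.mul_le_mul_right (a * x) hc3]
      exact Nat.le_of_mul_le_mul_left this hc
    · have := Nat.mul_le_mul_left (a * x) (show 3 ≤ b * y from h3)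
      linarith
  have ha7 : a < 7 * b := by
    have h1 : a * (x + y) ≤ (a + b) * x := by linarith
    have h2 : x * (4 * (a * a)) ≤ x * (3 * ((a + b) * (a + b))) := by
      nlinarith [Nat.mul_le_mul_left a hratio, Nat.mul_le_mul_left (3 * (a + b)) h1]
    have h3 := Nat.le_of_mul_le_mul_left h2 hx
    by_contra! h
    nlinarith
  have hlt : a + b < a * b * y := by
    have : c * x * (a + b) < c * x * (a * b * y) := by
      have : 0 < a * b * x * y := by positivity
      nlinarith [Nat.zero_le (c * ((a + b) * y))]
    exact lt_of_mul_lt_mul_left this (Nat.zero_le _)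
  have hb9 : b < 9 := by nlinarith
  have hy9 : y < 9 := by nlinarith
  obtain ⟨hX, hC⟩ := symmetricBounds_of_small_left b (Finset.mem_range.2 hb9) y
    (Finset.mem_range.2 hy9) (Finset.mem_Icc.2 ⟨hby, hby8⟩) a (Finset.mem_Ico.2 ⟨hab, ha7⟩) hlt
  obtain ⟨n, hn⟩ := Nat.exists_eq_add_of_lt hlt
  have hN : a * b * y - (a + b) = n + 1 := by omega
  rw [hN] at hX hC
  have hlin : (n + 1) * c * x = y * (a + b) * c + a * b * y * x := by
    have h := congrArg (fun t => c * x * t) hn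
    linarith
  have hD : 0 < a * b * y := by omega
  have hP : 0 < y * (a + b) := by positivity
  rcases le_two_mul_or_le_two_mul hx hc hlin with h | h
  · exact hX.apply n.succ_pos hD hx hlin h hxy
  · exact hC.apply n.succ_pos hP hc (by linarith) h hxy

/-- Let `a, b, c, x, y` be positive integers with `a ≥ b` and `x ≥ y ≥ 2` satisfying
`1/c + (1/a + 1/b)·(1/x + 1/y) = 1` in ℚ. Then `x ≤ 30`, `y ≤ 8`, `a ≤ 35`, `b ≤ 4`
and `c ≤ 36`. -/
theorem statement_5 (a b c x y : ℕ)
    (ha : 0 < a) (hb : 0 < b) (hc : 0 < c) (hx : 0 < x) (hy : 0 < y)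
    (hab : b ≤ a) (hxy : y ≤ x) (hy2 : 2 ≤ y)
    (heq : 1 / (c : ℚ) + (1 / (a : ℚ) + 1 / (b : ℚ)) * (1 / (x : ℚ) + 1 / (y : ℚ)) = 1) :
    x ≤ 30 ∧ y ≤ 8 ∧ a ≤ 35 ∧ b ≤ 4 ∧ c ≤ 36 := by
  have hnat : a * b * x * y + c * ((a + b) * (x + y)) = c * (a * b * x * y) := by
    have : (a : ℚ) * b * x * y + c * ((a + b) * (x + y)) = c * (a * b * x * y) := by
      field_simp at heq
      linarith
    exact_mod_cast this
  rcases le_total (a * y) (b * x) with h | h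
  · exact (symmetricBounds_of_mul_le_mul ha hb hc hx hy hab hxy (by nlinarith) hnat h).1 hy2
  · exact (symmetricBounds_of_mul_le_mul hx hy hc ha hb hxy hab (by nlinarith)
      (by linarith) (by linarith)).2 hy2
end

section
/- Let y, w, a, b, c be positive integers with y ≥ 3 and w ≤ 2, satisfying the equation 1/c + 1/a + 1/b + (2/a + w/b)·(1/y + 1/2 − 1) = 1 in ℚ. Then y ≤ 18, a ≤ 28, b ≤ 10 and c ≤ 30. -/
theorem two_le_of_eq {y k a b c : ℤ} (ha : 0 < a) (hb : 0 < b) (hc : 0 < c) (hk : 0 < k)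
    (h : 2 * y * a * b + 4 * b * c + k * a * c = 2 * y * a * b * c) : 2 ≤ c := by
  by_contra hlt
  obtain rfl : c = 1 := by omega
  nlinarith [mul_pos hk ha]

theorem y_le_of_eq_four {y a b c : ℤ} (hy : 3 ≤ y) (ha : 0 < a) (hb : 0 < b) (hc : 2 ≤ c)
    (h : 2 * y * a * b + 4 * b * c + 4 * a * c = 2 * y * a * b * c) : y ≤ 18 := by
  have hab : 0 < a * b := mul_pos ha hb
  have hyab : 0 < y * a * b := by positivity
  have h₁ : c * (y * a * b) ≤ c * (4 * a + 4 * b) := by nlinarith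
  have h₂ : y * a * b ≤ 4 * a + 4 * b := le_of_mul_le_mul_left h₁ (by omega)
  have h₃ : (a * b) * y ≤ (a * b) * 18 := by nlinarith
  exact le_of_mul_le_mul_left h₃ hab

theorem y_le_of_eq_add_two {y a b c : ℤ} (hy : 3 ≤ y) (ha : 0 < a) (hb : 0 < b) (hc : 2 ≤ c)
    (h : 2 * y * a * b + 4 * b * c + (y + 2) * a * c = 2 * y * a * b * c) : y ≤ 18 := by
  have hab : 0 < a * b := mul_pos ha hb
  have hyab : 0 < y * a * b := by positivity
  have hya : 0 < y * a := by positivity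
  rcases (by omega : b = 1 ∨ 2 ≤ b) with rfl | hb2
  · have hac : 0 < a * c := by positivity
    have hc3 : 3 ≤ c := by
      by_contra hlt
      obtain rfl : c = 2 := by omega
      nlinarith
    have h₁ : (a * c) * y ≤ (a * c) * 18 := by nlinarith
    exact le_of_mul_le_mul_left h₁ hac
  · have h₁ : c * (y * a * b) ≤ c * (4 * b + (y + 2) * a) := by nlinarith
    have h₂ : y * a * b ≤ 4 * b + (y + 2) * a := le_of_mul_le_mul_left h₁ (by omega)
    have h₃ : (a * b) * y ≤ (a * b) * 18 := by nlinarith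
    exact le_of_mul_le_mul_left h₃ hab

theorem b_le_of_eq {y k a b c : ℤ} (hy : 3 ≤ y) (hy18 : y ≤ 18) (hk : k = 4 ∨ k = y + 2)
    (ha : 0 < a) (hb : 0 < b) (hc : 2 ≤ c)
    (h : 2 * y * a * b + 4 * b * c + k * a * c = 2 * y * a * b * c) : b ≤ 10 := by
  have hk0 : 0 < k := by omega
  have hc0 : 0 < c := by omega
  by_contra! hlt
  have hb_mul : b * (2 * y * (a * c) - 2 * y * a - 4 * c) = k * (a * c) := by linear_combination -h
  have hpos : 0 < 2 * y * (a * c) - 2 * y * a - 4 * c :=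
    pos_of_mul_pos_right (by rw [hb_mul]; positivity) hb.le
  have hle : 11 * (2 * y * (a * c) - 2 * y * a - 4 * c) ≤ k * (a * c) := by nlinarith
  clear hb_mul h
  rcases (by omega : a = 1 ∨ a = 2 ∨ a = 3 ∨ 4 ≤ a) with rfl | rfl | rfl | ha4
  iterate 3 rcases hk with rfl | rfl <;> interval_cases y <;> omega
  have h₁ : 4 * c ≤ a * c := by nlinarith
  have h₂ : 2 * a ≤ a * c := by nlinarith
  generalize a * c = p at *
  rcases hk with rfl | rfl <;> interval_cases y <;> omega

set_option maxHeartbeats 1000000 in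
theorem a_le_of_eq {y k a b c : ℤ} (hy : 3 ≤ y) (hy18 : y ≤ 18) (hk : k = 4 ∨ k = y + 2)
    (ha : 0 < a) (hb : 0 < b) (hb10 : b ≤ 10) (hc : 0 < c)
    (h : 2 * y * a * b + 4 * b * c + k * a * c = 2 * y * a * b * c) : a ≤ 28 := by
  by_contra! hlt
  have ha_mul : a * (2 * y * (b * c) - 2 * y * b - k * c) = 4 * (b * c) := by linear_combination -h
  have hpos : 0 < 2 * y * (b * c) - 2 * y * b - k * c :=
    pos_of_mul_pos_right (by rw [ha_mul]; positivity) ha.le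
  have hle : 29 * (2 * y * (b * c) - 2 * y * b - k * c) ≤ 4 * (b * c) := by nlinarith
  clear ha_mul h
  rcases hk with rfl | rfl <;> interval_cases y <;> interval_cases b <;> omega

set_option maxHeartbeats 1000000 in
theorem c_le_of_eq {y k a b c : ℤ} (hy : 3 ≤ y) (hy18 : y ≤ 18) (hk : k = 4 ∨ k = y + 2)
    (ha : 0 < a) (hb : 0 < b) (hb10 : b ≤ 10) (hc : 0 < c)
    (h : 2 * y * a * b + 4 * b * c + k * a * c = 2 * y * a * b * c) : c ≤ 30 := by
  have hy0 : 0 < y := by omega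
  by_contra! hlt
  have hc_mul : c * (2 * y * (a * b) - 4 * b - k * a) = 2 * y * (a * b) := by
    linear_combination -h
  have hpos : 0 < 2 * y * (a * b) - 4 * b - k * a :=
    pos_of_mul_pos_right (by rw [hc_mul]; positivity) hc.le
  have hle : 31 * (2 * y * (a * b) - 4 * b - k * a) ≤ 2 * y * (a * b) := by nlinarith
  clear hc_mul h
  rcases hk with rfl | rfl <;> interval_cases y <;> interval_cases b <;> omega

theorem bounds_of_eq {y k a b c : ℤ} (hy : 3 ≤ y) (hk : k = 4 ∨ k = y + 2)
    (ha : 0 < a) (hb : 0 < b) (hc : 0 < c)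
    (h : 2 * y * a * b + 4 * b * c + k * a * c = 2 * y * a * b * c) :
    y ≤ 18 ∧ a ≤ 28 ∧ b ≤ 10 ∧ c ≤ 30 := by
  have hk0 : 0 < k := by omega
  have hc2 : 2 ≤ c := two_le_of_eq ha hb hc hk0 h
  have hy18 : y ≤ 18 := by
    rcases hk with rfl | rfl
    · exact y_le_of_eq_four hy ha hb hc2 h
    · exact y_le_of_eq_add_two hy ha hb hc2 h
  have hb10 : b ≤ 10 := b_le_of_eq hy hy18 hk ha hb hc2 h
  exact ⟨hy18, a_le_of_eq hy hy18 hk ha hb hb10 hc h, hb10,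
    c_le_of_eq hy hy18 hk ha hb hb10 hc h⟩

/-- Let `y, w, a, b, c` be positive integers with `y ≥ 3` and `w ≤ 2`, satisfying
`1/c + 1/a + 1/b + (2/a + w/b)·(1/y + 1/2 − 1) = 1` in ℚ. Then `y ≤ 18`, `a ≤ 28`,
`b ≤ 10` and `c ≤ 30`. -/
theorem statement_8 (y w a b c : ℕ)
    (hy : 0 < y) (hw : 0 < w) (ha : 0 < a) (hb : 0 < b) (hc : 0 < c)
    (hy3 : 3 ≤ y) (hw2 : w ≤ 2)
    (heq : 1 / (c : ℚ) + 1 / (a : ℚ) + 1 / (b : ℚ) +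
      (2 / (a : ℚ) + (w : ℚ) / (b : ℚ)) * (1 / (y : ℚ) + 1 / 2 - 1) = 1) :
    y ≤ 18 ∧ a ≤ 28 ∧ b ≤ 10 ∧ c ≤ 30 := by
  have hy' : (y : ℚ) ≠ 0 := by positivity
  have ha' : (a : ℚ) ≠ 0 := by positivity
  have hb' : (b : ℚ) ≠ 0 := by positivity
  have hc' : (c : ℚ) ≠ 0 := by positivity
  have key : (2 * y * a * b + 4 * b * c + (2 * y - w * (y - 2)) * a * c : ℚ) =
      2 * y * a * b * c := by
    field_simp at heq
    linear_combination heq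
  have keyZ : (2 * y * a * b + 4 * b * c + (2 * y - w * (y - 2)) * a * c : ℤ) =
      2 * y * a * b * c := by exact_mod_cast key
  have hk : (2 * y - w * (y - 2) : ℤ) = 4 ∨ (2 * y - w * (y - 2) : ℤ) = y + 2 := by
    interval_cases w
    · right; push_cast; ring
    · left; push_cast; ring
  have := bounds_of_eq (by exact_mod_cast hy3) hk (by exact_mod_cast ha) (by exact_mod_cast hb)
    (by exact_mod_cast hc) keyZ
  exact_mod_cast this
end

section
/- Let z, w, a, b, c be positive integers with 3 ≤ z ≤ 5 and w ≤ z, satisfying the equation 1/c + 1/a + 1/b + (z/a + w/b)·(1/3 + 1/2 − 1) = 1 in ℚ. Then w ≤ 4, a ≤ 21, b ≤ 5 and c ≤ 24. -/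
/-- The solutions of `p / (6a) + q / (6b) + 1 / c = 1`, in denominator-free form, are bounded. -/
lemma bounds_of_egyptian_eq {p q a b c : ℕ} (hp : 0 < p) (hp3 : p ≤ 3) (hq : 0 < q) (hq5 : q ≤ 5)
    (ha : 0 < a) (hb : 0 < b) (hc : 0 < c)
    (h : p * b * c + q * a * c + 6 * a * b = 6 * a * b * c) :
    3 * a * b ≤ p * b + q * a ∧ a ≤ 21 ∧ b ≤ 5 ∧ c ≤ 24 := by
  have hab : 0 < a * b := Nat.mul_pos ha hb
  have hc2 : 2 ≤ c := by
    by_contra! hlt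
    obtain rfl : c = 1 := by omega
    have : 0 < p * b := Nat.mul_pos hp hb
    nlinarith
  have key : 3 * a * b ≤ p * b + q * a := by
    have : c * (3 * a * b) ≤ c * (p * b + q * a) := by nlinarith
    exact Nat.le_of_mul_le_mul_left this hc
  have hpb : p * b ≤ 3 * b := Nat.mul_le_mul_right b hp3
  have hqa : q * a ≤ 5 * a := Nat.mul_le_mul_right a hq5
  have hb5 : b ≤ 5 := by
    by_contra! hlt
    have ha1 : a = 1 := by
      by_contra! hne
      have : 2 ≤ a := by omega
      nlinarith
    subst ha1
    have hp3' : p = 3 := by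
      by_contra! hne
      have : p * b ≤ 2 * b := Nat.mul_le_mul_right b (by omega)
      omega
    subst hp3'
    have hqc : q * c ≤ 5 * c := Nat.mul_le_mul_right c hq5
    obtain rfl | hc3 : c = 2 ∨ 3 ≤ c := by omega
    · omega
    · nlinarith
  refine ⟨key, ?_, hb5, ?_⟩
  · by_contra! hlt
    have hc6 : c ≤ 6 := by
      by_contra! hlt'
      have : p * b * c ≤ 3 * b * c := Nat.mul_le_mul_right c hpb
      interval_cases b <;> interval_cases q <;> first | omega | nlinarith
    interval_cases b <;> interval_cases q <;> first
      | omega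
      | (interval_cases p <;> interval_cases c <;> omega)
  · by_contra! hlt
    have ha3 : a ≤ 3 := by
      by_contra! hlt'
      have : p * b * c ≤ 3 * b * c := Nat.mul_le_mul_right c hpb
      interval_cases b <;> interval_cases q <;> first | omega | nlinarith
    interval_cases b <;> interval_cases q <;> interval_cases a <;> first
      | omega
      | (interval_cases p <;> omega)

/-- Let `z, w, a, b, c` be positive integers with `3 ≤ z ≤ 5` and `w ≤ z`, satisfying
`1/c + 1/a + 1/b + (z/a + w/b)·(1/3 + 1/2 − 1) = 1` in ℚ. Then `w ≤ 4`, `a ≤ 21`,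
`b ≤ 5` and `c ≤ 24`. -/
theorem statement_9 (z w a b c : ℕ)
    (hz : 0 < z) (hw : 0 < w) (ha : 0 < a) (hb : 0 < b) (hc : 0 < c)
    (hz3 : 3 ≤ z) (hz5 : z ≤ 5) (hwz : w ≤ z)
    (heq : 1 / (c : ℚ) + 1 / (a : ℚ) + 1 / (b : ℚ) +
      ((z : ℚ) / (a : ℚ) + (w : ℚ) / (b : ℚ)) * (1 / 3 + 1 / 2 - 1) = 1) :
    w ≤ 4 ∧ a ≤ 21 ∧ b ≤ 5 ∧ c ≤ 24 := by
  have hnat : (6 - z) * b * c + (6 - w) * a * c + 6 * a * b = 6 * a * b * c := by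
    have ha' : (a : ℚ) ≠ 0 := by positivity
    have hb' : (b : ℚ) ≠ 0 := by positivity
    have hc' : (c : ℚ) ≠ 0 := by positivity
    field_simp at heq
    have hz6 : z ≤ 6 := by omega
    have hw6 : w ≤ 6 := by omega
    have : (((6 - z) * b * c + (6 - w) * a * c + 6 * a * b : ℕ) : ℚ) = (6 * a * b * c : ℕ) := by
      push_cast [Nat.cast_sub hz6, Nat.cast_sub hw6]
      linarith
    exact_mod_cast this
  obtain ⟨key, hbounds⟩ :=
    bounds_of_egyptian_eq (by omega) (by omega) (by omega) (by omega) ha hb hc hnat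
  refine ⟨?_, hbounds⟩
  by_contra! hlt
  obtain rfl : w = 5 := by omega
  obtain rfl : z = 5 := by omega
  nlinarith
end

section
/- Let z, w, a, b, c be positive integers with 3 ≤ z ≤ 5 and w ≤ 2, satisfying the equation 1/c + 1/a + 1/b + (2/a + w/b)·(1/z + 1/3 − 1) = 1 in ℚ. Then z ≤ 4, a ≤ 4, b ≤ 4 and c ≤ 6. -/
lemma one_div_natCast_cases {n : ℕ} (hn : 0 < n) :
    (n = 1 ∧ 1 / (n : ℚ) = 1) ∨ (n = 2 ∧ 1 / (n : ℚ) = 1 / 2) ∨ (n = 3 ∧ 1 / (n : ℚ) = 1 / 3) ∨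
    (n = 4 ∧ 1 / (n : ℚ) = 1 / 4) ∨ (n = 5 ∧ 1 / (n : ℚ) = 1 / 5) ∨
    (n = 6 ∧ 1 / (n : ℚ) = 1 / 6) ∨ (7 ≤ n ∧ 1 / (n : ℚ) ≤ 1 / 7) := by
  rcases le_or_gt 7 n with h | h
  · have h7 : (7 : ℚ) ≤ n := by exact_mod_cast h
    have hle : 1 / (n : ℚ) ≤ 1 / 7 := one_div_le_one_div_of_le (by norm_num) h7
    tauto
  · interval_cases n <;> norm_num

lemma one_div_natCast_eq_one_or_le_half {n : ℕ} (hn : 0 < n) :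
    1 / (n : ℚ) = 1 ∨ 1 / (n : ℚ) ≤ 1 / 2 := by
  obtain rfl | h : n = 1 ∨ 2 ≤ n := by omega
  · simp
  · exact .inr (one_div_le_one_div_of_le (by norm_num) (by exact_mod_cast h))

lemma bounds_of_linear_eq_one {p q : ℚ} {a b c : ℕ} (ha : 0 < a) (hb : 0 < b) (hc : 0 < c)
    (hpq : p = 1 / 3 ∧ q = 2 / 3 ∨ p = 1 / 3 ∧ q = 1 / 3 ∨ p = 1 / 6 ∧ q = 7 / 12)
    (h : 1 / (c : ℚ) + p * (1 / (a : ℚ)) + q * (1 / (b : ℚ)) = 1) :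
    a ≤ 4 ∧ b ≤ 4 ∧ c ≤ 6 := by
  have hA := one_div_natCast_cases ha
  have hB := one_div_natCast_cases hb
  have hC := one_div_natCast_cases hc
  have hA0 : 0 < 1 / (a : ℚ) := by positivity
  have hB0 : 0 < 1 / (b : ℚ) := by positivity
  have hA1 : 1 / (a : ℚ) ≤ 1 := (one_div _).trans_le (Nat.cast_inv_le_one a)
  generalize 1 / (a : ℚ) = x at *
  generalize 1 / (b : ℚ) = y at *
  have hC0 : 0 < 1 / (c : ℚ) := by positivity
  generalize 1 / (c : ℚ) = u at *
  rcases hpq with ⟨rfl, rfl⟩ | ⟨rfl, rfl⟩ | ⟨rfl, rfl⟩ <;>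
    rcases hC with ⟨hc, hu⟩ | ⟨hc, hu⟩ | ⟨hc, hu⟩ | ⟨hc, hu⟩ | ⟨hc, hu⟩ | ⟨hc, hu⟩ | ⟨hc, hu⟩ <;>
    rcases hB with ⟨hb, hy⟩ | ⟨hb, hy⟩ | ⟨hb, hy⟩ | ⟨hb, hy⟩ | ⟨hb, hy⟩ | ⟨hb, hy⟩ | ⟨hb, hy⟩ <;>
    first
    | (exfalso; clear hA; linarith only [h, hu, hy, hA0, hB0, hC0, hA1])
    | (rcases hA with ⟨ha, hx⟩ | ⟨ha, hx⟩ | ⟨ha, hx⟩ | ⟨ha, hx⟩ | ⟨ha, hx⟩ | ⟨ha, hx⟩ | ⟨ha, hx⟩ <;>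
        first
        | omega
        | (exfalso; linarith only [h, hu, hy, hx, hA0, hB0, hC0]))

/-- Let `z, w, a, b, c` be positive integers with `3 ≤ z ≤ 5` and `w ≤ 2`, satisfying
`1/c + 1/a + 1/b + (2/a + w/b)·(1/z + 1/3 − 1) = 1` in ℚ. Then `z ≤ 4`, `a ≤ 4`,
`b ≤ 4` and `c ≤ 6`. -/
theorem statement_10 (z w a b c : ℕ)
    (hz : 0 < z) (hw : 0 < w) (ha : 0 < a) (hb : 0 < b) (hc : 0 < c)
    (hz3 : 3 ≤ z) (hz5 : z ≤ 5) (hw2 : w ≤ 2)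
    (heq : 1 / (c : ℚ) + 1 / (a : ℚ) + 1 / (b : ℚ) +
      (2 / (a : ℚ) + (w : ℚ) / (b : ℚ)) * (1 / (z : ℚ) + 1 / 3 - 1) = 1) :
    z ≤ 4 ∧ a ≤ 4 ∧ b ≤ 4 ∧ c ≤ 6 := by
  have hA0 : 0 < 1 / (a : ℚ) := by positivity
  have hB0 : 0 < 1 / (b : ℚ) := by positivity
  have hA1 : 1 / (a : ℚ) ≤ 1 := (one_div _).trans_le (Nat.cast_inv_le_one a)
  have hB1 : 1 / (b : ℚ) ≤ 1 := (one_div _).trans_le (Nat.cast_inv_le_one b)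
  have hB := one_div_natCast_eq_one_or_le_half hb
  have hC := one_div_natCast_eq_one_or_le_half hc
  rw [div_eq_mul_one_div 2 (a : ℚ), div_eq_mul_one_div (w : ℚ) (b : ℚ)] at heq
  obtain rfl | rfl | rfl : z = 3 ∨ z = 4 ∨ z = 5 := by omega
  all_goals obtain rfl | rfl : w = 1 ∨ w = 2 := by omega
  all_goals push_cast at heq
  · exact ⟨by norm_num, bounds_of_linear_eq_one (p := 1 / 3) (q := 2 / 3) ha hb hc (by simp)
      (by linarith)⟩
  · exact ⟨by norm_num, bounds_of_linear_eq_one (p := 1 / 3) (q := 1 / 3) ha hb hc (by simp)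
      (by linarith)⟩
  · exact ⟨by norm_num, bounds_of_linear_eq_one (p := 1 / 6) (q := 7 / 12) ha hb hc (by simp)
      (by linarith)⟩
  · rcases hC with hC | hC <;> exfalso <;> linarith
  · rcases one_div_natCast_cases hc with ⟨-, hC⟩ | ⟨-, hC⟩ | ⟨-, hC⟩ | ⟨-, hC⟩ | ⟨-, hC⟩ | ⟨-, hC⟩ |
      ⟨-, hC⟩ <;> rcases hB with hB | hB <;> exfalso <;> linarith
  · rcases hC with hC | hC <;> exfalso <;> linarith
end

section
/- Let z, w, a, b, c be positive integers with 4 ≤ z ≤ 5 and w ≤ 3, satisfying the equation 1/c + 1/a + 1/b + (3/a + w/b)·(1/z + 1/2 − 1) = 1 in ℚ. Then a ≤ 5, b ≤ 3 and c ≤ 8. -/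
/-- Let `z, w, a, b, c` be positive integers with `4 ≤ z ≤ 5` and `w ≤ 3`, satisfying
`1/c + 1/a + 1/b + (3/a + w/b)·(1/z + 1/2 − 1) = 1` in ℚ. Then `a ≤ 5`, `b ≤ 3` and
`c ≤ 8`. -/
theorem statement_11 (z w a b c : ℕ)
    (hz : 0 < z) (hw : 0 < w) (ha : 0 < a) (hb : 0 < b) (hc : 0 < c)
    (hz4 : 4 ≤ z) (hz5 : z ≤ 5) (hw3 : w ≤ 3)
    (heq : 1 / (c : ℚ) + 1 / (a : ℚ) + 1 / (b : ℚ) +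
      (3 / (a : ℚ) + (w : ℚ) / (b : ℚ)) * (1 / (z : ℚ) + 1 / 2 - 1) = 1) :
    a ≤ 5 ∧ b ≤ 3 ∧ c ≤ 8 := by
  have hmul : 2 * z * (a * b) + 2 * z * (b * c) + 2 * z * (a * c) + (3 * b + w * a) * (2 * c)
      = 2 * z * (a * b * c) + (3 * b + w * a) * (z * c) := by
    have : (z : ℚ) ≠ 0 := by positivity
    have : (a : ℚ) ≠ 0 := by positivity
    have : (b : ℚ) ≠ 0 := by positivity
    have : (c : ℚ) ≠ 0 := by positivity
    field_simp at heq
    have h : (2 * z * (a * b) + 2 * z * (b * c) + 2 * z * (a * c) + (3 * b + w * a) * (2 * c) : ℚ)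
        = 2 * z * (a * b * c) + (3 * b + w * a) * (z * c) := by
      linear_combination heq
    exact_mod_cast h
  clear heq
  have hab : 0 < a * b := Nat.mul_pos ha hb
  have hbc : 0 < b * c := Nat.mul_pos hb hc
  have hac : 0 < a * c := Nat.mul_pos ha hc
  have hc2 : 2 ≤ c := by
    by_contra! h
    obtain rfl : c = 1 := by omega
    interval_cases z <;> interval_cases w <;> ring_nf at hmul hbc hac <;> omega
  have hb3 : b ≤ 3 := by
    by_contra! h
    obtain ⟨d, rfl⟩ := Nat.exists_eq_add_of_le hc2
    obtain ⟨e, rfl⟩ := Nat.exists_eq_add_of_le (show 4 ≤ b from h)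
    obtain ⟨f, rfl⟩ := Nat.exists_eq_add_of_le (show 1 ≤ a from ha)
    interval_cases z <;> interval_cases w <;> ring_nf at hmul <;> nlinarith [Nat.zero_le (d * e), Nat.zero_le (e * f), Nat.zero_le (d * f), Nat.zero_le (d * e * f)]
  have hc8 : c ≤ 8 := by
    by_contra! h
    obtain ⟨d, rfl⟩ := Nat.exists_eq_add_of_le (show 9 ≤ c from h)
    rcases Nat.lt_or_ge a 2 with h2 | h2
    · obtain rfl : a = 1 := by omega
      interval_cases z <;> interval_cases w <;> interval_cases b <;> omega
    · obtain ⟨f, rfl⟩ := Nat.exists_eq_add_of_le h2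
      interval_cases z <;> interval_cases w <;> interval_cases b <;> ring_nf at hmul <;>
        nlinarith [Nat.zero_le (d * f)]
  refine ⟨?_, hb3, hc8⟩
  clear hab hbc hac
  interval_cases z <;> interval_cases w <;> interval_cases b <;> interval_cases c <;> omega
end
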